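/- Let F : ℝⁿ → ℝᵐ be continuously differentiable, ψ(x,d) = max_{1≤i≤m} ⟨∇Fᵢ(x), d⟩, and v(x) the unique minimizer over d of ψ(x,d) + ½‖d‖². Let (xₖ) be a sequence of non-Pareto-critical points and suppose there is γ* > 0 with γₖ ≥ γ* for all k; let Nₖ = min{k, N} for fixed N ∈ ℤ₊ and define d₀ = γ₀ v(x₀) and, for k ≥ 1, dₖ = γₖ v(xₖ) + Σ_{j=1}^{Nₖ} β_{kj} d_{k−j} with β_{kj} = −(1/Nₖ) ψ(xₖ, v(xₖ)) / φ_{kj}, where the parameters satisfy φ_{kj} > (ψ(xₖ, d_{k−j}) + ‖JF(xₖ)‖·‖d_{k−j}‖)/γₖ and ‖JF(xₖ)‖ = max_{1≤i≤m} ‖∇Fᵢ(xₖ)‖. Then dₖ satisfies the sufficient descent condition ψ(xₖ, dₖ) ≤ (γ*/2) ψ(xₖ, v(xₖ)) for all k. -/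

import Mathlib

open scoped RealInnerProductSpace

noncomputable def psi {n m : ℕ} [NeZero m]
    (F : Fin m → EuclideanSpace ℝ (Fin n) → ℝ)
    (x d : EuclideanSpace ℝ (Fin n)) : ℝ :=
  Finset.univ.sup' Finset.univ_nonempty fun i => ⟪gradient (F i) x, d⟫

theorem inner_gradient_le_psi {n m : ℕ} [NeZero m]
    (F : Fin m → EuclideanSpace ℝ (Fin n) → ℝ) (x d : EuclideanSpace ℝ (Fin n)) (i : Fin m) :
    ⟪gradient (F i) x, d⟫ ≤ psi F x d :=
  Finset.le_sup' (fun i => ⟪gradient (F i) x, d⟫) (Finset.mem_univ i)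

theorem psi_zero_right {n m : ℕ} [NeZero m]
    (F : Fin m → EuclideanSpace ℝ (Fin n) → ℝ) (x : EuclideanSpace ℝ (Fin n)) :
    psi F x 0 = 0 := by
  simp [psi]

theorem inner_gradient_div_le {n m : ℕ} [NeZero m]
    (F : Fin m → EuclideanSpace ℝ (Fin n) → ℝ) (x d : EuclideanSpace ℝ (Fin n))
    {γ φ : ℝ} (hγ : 0 < γ)
    (hφ : (psi F x d + (Finset.univ.sup' Finset.univ_nonempty fun i => ‖gradient (F i) x‖) *
      ‖d‖) / γ < φ) (i : Fin m) :
    ⟪gradient (F i) x, d⟫ / φ ≤ γ / 2 := by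
  have hψ := inner_gradient_le_psi F x d i
  have hJ := mul_le_mul_of_nonneg_right
    (Finset.le_sup' (fun i => ‖gradient (F i) x‖) (Finset.mem_univ i)) (norm_nonneg d)
  have habs := abs_le.mp (abs_real_inner_le_norm (gradient (F i) x) d)
  rw [div_lt_iff₀ hγ] at hφ
  have hφ0 : 0 < φ := by
    refine pos_of_mul_pos_left ?_ hγ.le
    linarith [habs.1]
  rw [div_le_iff₀ hφ0]
  linarith [habs.2]

theorem stmt19 {n m : ℕ} [NeZero m]
    (F : Fin m → EuclideanSpace ℝ (Fin n) → ℝ)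
    (hF : ∀ i, ContDiff ℝ 1 (F i))
    (v : EuclideanSpace ℝ (Fin n) → EuclideanSpace ℝ (Fin n))
    (hv : ∀ x d, psi F x (v x) + ‖v x‖ ^ 2 / 2 ≤ psi F x d + ‖d‖ ^ 2 / 2)
    (x : ℕ → EuclideanSpace ℝ (Fin n))
    (hncrit : ∀ k, ∃ dd, psi F (x k) dd < 0)
    (γ : ℕ → ℝ) (γstar : ℝ) (hγstar : 0 < γstar) (hγ : ∀ k, γstar ≤ γ k)
    (N : ℕ) (hN : 0 < N)
    (β φ : ℕ → ℕ → ℝ)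
    (d : ℕ → EuclideanSpace ℝ (Fin n))
    (hd0 : d 0 = γ 0 • v (x 0))
    (hdk : ∀ k, 1 ≤ k → d k = γ k • v (x k) +
      ∑ j ∈ Finset.Icc 1 (min k N), β k j • d (k - j))
    (hβ : ∀ k, 1 ≤ k → ∀ j ∈ Finset.Icc 1 (min k N),
      β k j = -(1 / (min k N : ℝ)) * psi F (x k) (v (x k)) / φ k j)
    (hφ : ∀ k, 1 ≤ k → ∀ j ∈ Finset.Icc 1 (min k N),
      φ k j > (psi F (x k) (d (k - j)) +
        (Finset.univ.sup' Finset.univ_nonempty fun i => ‖gradient (F i) (x k)‖) *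
          ‖d (k - j)‖) / γ k) :
    ∀ k, psi F (x k) (d k) ≤ (γstar / 2) * psi F (x k) (v (x k)) := by
  intro k
  have hγk : 0 < γ k := hγstar.trans_le (hγ k)
  have hp : psi F (x k) (v (x k)) ≤ 0 := by
    have h := hv (x k) 0
    rw [psi_zero_right] at h
    norm_num at h
    linarith [sq_nonneg ‖v (x k)‖]
  refine Finset.sup'_le _ _ fun i _ => ?_
  have hi := mul_le_mul_of_nonneg_left (inner_gradient_le_psi F (x k) (v (x k)) i) hγk.le
  have hγp := mul_le_mul_of_nonpos_right (hγ k) hp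
  rcases Nat.eq_zero_or_pos k with rfl | hk
  · rw [hd0, real_inner_smul_right]
    linarith [mul_nonpos_of_nonneg_of_nonpos hγstar.le hp]
  · have hM : (0 : ℝ) < min (k : ℝ) (N : ℝ) := by
      rw [lt_min_iff]; exact ⟨by exact_mod_cast hk, by exact_mod_cast hN⟩
    have hsum : ∑ j ∈ Finset.Icc 1 (min k N), β k j * ⟪gradient (F i) (x k), d (k - j)⟫ ≤
        -psi F (x k) (v (x k)) * (γ k / 2) := by
      calc
        _ ≤ ∑ j ∈ Finset.Icc 1 (min k N),
            -psi F (x k) (v (x k)) / min (k : ℝ) (N : ℝ) * (γ k / 2) := by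
          refine Finset.sum_le_sum fun j hj => ?_
          have h := mul_le_mul_of_nonneg_left
            (inner_gradient_div_le F (x k) (d (k - j)) hγk (hφ k hk j hj) i)
            (div_nonneg (neg_nonneg.mpr hp) hM.le)
          refine le_of_eq_of_le ?_ h
          rw [hβ k hk j hj]
          ring
        _ = _ := by
          rw [Finset.sum_const, Nat.card_Icc, nsmul_eq_mul, Nat.add_sub_cancel, Nat.cast_min]
          field_simp
    rw [hdk k hk, inner_add_right, real_inner_smul_right, inner_sum]
    simp only [real_inner_smul_right]
    linarith
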